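/- Let ξ ∈ (−π,π), a ∈ ℝ, let g : ℝ → ℝ be 2π-periodic and twice continuously differentiable, and set f(x) = a·r₀(x−ξ) + g(x), where r₀ is the ramp function extended 2π-periodically. Let σ : (0,1] → ℝ be such that h(η) := σ(η)/η extends to a continuously differentiable function on [0,1] with ∫₀¹ h(η) dη = π. Then S_N^σ[f](ξ) → a = [f](ξ) as N → ∞, while for every x with x − ξ ∉ 2πℤ, S_N^σ[f](x) → 0 as N → ∞. -/

import Mathlib

open Real MeasureTheory Filter

/-- The k-th Fourier coefficient `f̂_k = (1/(2π)) ∫_{-π}^{π} f(x) e^{-ikx} dx`. -/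
noncomputable def fourierCoef (f : ℝ → ℂ) (k : ℤ) : ℂ :=
  (1 / (2 * (π : ℂ))) * ∫ x in (-π)..π, f x * Complex.exp (-Complex.I * k * x)

/-- The concentration factor sum `S_N^σ[f](x) = i Σ_{0<|k|≤N} f̂_k sgn(k) σ(|k|/N) e^{ikx}`. -/
noncomputable def concSum (σ : ℝ → ℝ) (N : ℕ) (f : ℝ → ℂ) (x : ℝ) : ℂ :=
  Complex.I * ∑ k ∈ Finset.Icc (-(N : ℤ)) (N : ℤ) \ {0},
    fourierCoef f k * (Int.sign k : ℂ) * (σ (|(k : ℝ)| / N) : ℂ) * Complex.exp (Complex.I * k * x)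

open Topology

section WeightedMeans

lemma sum_range_succ_mul_eq_sub {R : Type*} [CommRing R] (u e : ℕ → R) (n : ℕ) :
    ∑ j ∈ Finset.range n, u (j + 1) * e j =
      u n * ∑ j ∈ Finset.range n, e j -
        ∑ j ∈ Finset.range n, (u (j + 1) - u j) * ∑ i ∈ Finset.range j, e i := by
  induction n with
  | zero => simp
  | succ n ih => rw [Finset.sum_range_succ, ih, Finset.sum_range_succ, Finset.sum_range_succ]; ring

lemma div_mem_Icc_zero_one {j N : ℕ} (hN : 0 < N) (hj : j ≤ N) :
    (j : ℝ) / N ∈ Set.Icc (0 : ℝ) 1 := by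
  have : (0 : ℝ) < N := by exact_mod_cast hN
  exact ⟨by positivity, (div_le_one this).2 (by exact_mod_cast hj)⟩

lemma LipschitzOnWith.abs_sub_div_le {K : NNReal} {h : ℝ → ℝ}
    (hh : LipschitzOnWith K h (Set.Icc 0 1)) {j N : ℕ} (hN : 0 < N) (hj : j < N) {x : ℝ}
    (hx : x ∈ Set.Icc ((j : ℝ) / N) ((j + 1 : ℕ) / N)) :
    |h ((j + 1 : ℕ) / N) - h x| ≤ K / N := by
  have hN' : (0 : ℝ) < N := by exact_mod_cast hN
  have h0 := div_mem_Icc_zero_one hN hj.le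
  have h1 := div_mem_Icc_zero_one hN (show j + 1 ≤ N from hj)
  have := hh.dist_le_mul _ h1 x ⟨h0.1.trans hx.1, hx.2.trans h1.2⟩
  rw [Real.dist_eq, Real.dist_eq] at this
  refine this.trans ?_
  rw [div_eq_mul_inv (K : ℝ)]
  refine mul_le_mul_of_nonneg_left ?_ K.2
  rw [abs_of_nonneg (by linarith [hx.2])]
  have h2 : ((j + 1 : ℕ) : ℝ) / N = j / N + (N : ℝ)⁻¹ := by push_cast; field_simp
  linarith [hx.1]

/-- Right-endpoint Riemann sums of a Lipschitz function converge to the integral. -/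
lemma LipschitzOnWith.tendsto_riemannSum {K : NNReal} {h : ℝ → ℝ}
    (hh : LipschitzOnWith K h (Set.Icc 0 1)) :
    Tendsto (fun N : ℕ => (N : ℝ)⁻¹ * ∑ j ∈ Finset.range N, h ((j + 1 : ℕ) / N)) atTop
      (𝓝 (∫ x in (0 : ℝ)..1, h x)) := by
  rw [tendsto_iff_norm_sub_tendsto_zero]
  refine squeeze_zero' (.of_forall fun _ => norm_nonneg _) ?_
    (tendsto_const_div_atTop_nhds_zero_nat (K : ℝ))
  filter_upwards [eventually_gt_atTop 0] with N hN
  have hN' : (0 : ℝ) < N := by exact_mod_cast hN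
  have hle (j : ℕ) : (j : ℝ) / N ≤ (j + 1 : ℕ) / N := by gcongr; simp
  have hint (j : ℕ) (hj : j < N) :
      IntervalIntegrable h volume ((j : ℝ) / N) ((j + 1 : ℕ) / N) := by
    refine (hh.continuousOn.mono ?_).intervalIntegrable
    rw [Set.uIcc_of_le (hle j)]
    exact Set.Icc_subset_Icc (div_mem_Icc_zero_one hN hj.le).1
      (div_mem_Icc_zero_one hN (Nat.succ_le_of_lt hj)).2
  have hsum := intervalIntegral.sum_integral_adjacent_intervals (μ := volume) (f := h)
    (a := fun j : ℕ => (j : ℝ) / N) (n := N) hint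
  simp only [Nat.cast_zero, zero_div, div_self hN'.ne'] at hsum
  rw [← hsum, Finset.mul_sum, ← Finset.sum_sub_distrib]
  refine (norm_sum_le_of_le (Finset.range N) (f := _) (n := fun _ => (K : ℝ) / N * (N : ℝ)⁻¹)
    fun j hj => ?_).trans ?_
  · rw [Finset.mem_range] at hj
    have hlen : ((j + 1 : ℕ) : ℝ) / N - j / N = (N : ℝ)⁻¹ := by push_cast; field_simp; ring
    have hconst : (N : ℝ)⁻¹ * h ((j + 1 : ℕ) / N) =
        ∫ _ in ((j : ℝ) / N)..((j + 1 : ℕ) / N), h ((j + 1 : ℕ) / N) := by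
      rw [intervalIntegral.integral_const, hlen, smul_eq_mul]
    rw [hconst, ← intervalIntegral.integral_sub (by simp) (hint j hj)]
    refine (intervalIntegral.norm_integral_le_of_norm_le_const (C := K / N) fun x hx => ?_).trans ?_
    · rw [Set.uIoc_of_le (hle j)] at hx
      exact hh.abs_sub_div_le hN hj ⟨hx.1.le, hx.2⟩
    · rw [hlen, abs_of_pos (inv_pos.2 hN')]
  · simp only [Finset.sum_const, Finset.card_range, nsmul_eq_mul]
    exact le_of_eq (by field_simp)

lemma LipschitzOnWith.tendsto_weighted_mean_zero {K : NNReal} {h : ℝ → ℝ}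
    (hh : LipschitzOnWith K h (Set.Icc 0 1)) {e : ℕ → ℂ}
    (he : Tendsto (fun N : ℕ => (N : ℂ)⁻¹ * ∑ j ∈ Finset.range N, e j) atTop (𝓝 0)) :
    Tendsto (fun N : ℕ => (N : ℂ)⁻¹ * ∑ j ∈ Finset.range N, (h ((j + 1 : ℕ) / N) : ℂ) * e j)
      atTop (𝓝 0) := by
  set m : ℕ → ℝ := fun N => ‖(N : ℂ)⁻¹ * ∑ j ∈ Finset.range N, e j‖ with hm
  have hm0 : Tendsto m atTop (𝓝 0) := by simpa only [norm_zero] using he.norm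
  have hlim : Tendsto (fun N : ℕ => |h 1| * m N + K * ((N : ℝ)⁻¹ * ∑ j ∈ Finset.range N, m j))
      atTop (𝓝 0) := by
    simpa using (hm0.const_mul |h 1|).add (hm0.cesaro.const_mul (K : ℝ))
  refine squeeze_zero_norm' ?_ hlim
  filter_upwards [eventually_gt_atTop 0] with N hN
  have hN' : (0 : ℝ) < N := by exact_mod_cast hN
  have hE (j : ℕ) (hj : j < N) : ‖∑ i ∈ Finset.range j, e i‖ ≤ N * m j := by
    rcases Nat.eq_zero_or_pos j with rfl | hj0
    · simp [hm]
    · have hj' : (0 : ℝ) < j := by exact_mod_cast hj0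
      have : ‖∑ i ∈ Finset.range j, e i‖ = j * m j := by
        simp only [hm, norm_mul, norm_inv, Complex.norm_natCast]
        field_simp
      rw [this]
      gcongr
  rw [sum_range_succ_mul_eq_sub (fun j : ℕ => (h (j / N) : ℂ)) e N, mul_sub]
  refine (_root_.norm_sub_le _ _).trans (add_le_add ?_ ?_)
  · rw [div_self hN'.ne', mul_left_comm, norm_mul, Complex.norm_real, Real.norm_eq_abs]
  · rw [norm_mul, norm_inv, Complex.norm_natCast, mul_left_comm]
    gcongr
    rw [Finset.mul_sum]
    refine norm_sum_le_of_le _ fun j hj => ?_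
    rw [Finset.mem_range] at hj
    have hd : |h ((j + 1 : ℕ) / N) - h (j / N)| ≤ K / N :=
      hh.abs_sub_div_le hN hj ⟨le_rfl, by gcongr; simp⟩
    rw [norm_mul, ← Complex.ofReal_sub, Complex.norm_real, Real.norm_eq_abs]
    calc _ ≤ (K / N : ℝ) * (N * m j) := mul_le_mul hd (hE j hj) (norm_nonneg _) (by positivity)
      _ = K * m j := by field_simp

/-- If the Cesàro means of `c` converge to `L`, then its means weighted by the samples of a
Lipschitz function `h` converge to `(∫ h) * L`. -/
lemma LipschitzOnWith.tendsto_weighted_mean {K : NNReal} {h : ℝ → ℝ}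
    (hh : LipschitzOnWith K h (Set.Icc 0 1)) {c : ℕ → ℂ} {L : ℂ}
    (hc : Tendsto (fun N : ℕ => (N : ℂ)⁻¹ * ∑ j ∈ Finset.range N, c j) atTop (𝓝 L)) :
    Tendsto (fun N : ℕ => (N : ℂ)⁻¹ * ∑ j ∈ Finset.range N, (h ((j + 1 : ℕ) / N) : ℂ) * c j)
      atTop (𝓝 ((∫ x in (0 : ℝ)..1, h x : ℝ) * L)) := by
  have he : Tendsto (fun N : ℕ => (N : ℂ)⁻¹ * ∑ j ∈ Finset.range N, (c j - L)) atTop (𝓝 0) := by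
    rw [← sub_self L]
    refine (hc.sub_const L).congr' ?_
    filter_upwards [eventually_gt_atTop 0] with N hN
    have : (N : ℂ) ≠ 0 := by exact_mod_cast hN.ne'
    simp only [Finset.sum_sub_distrib, Finset.sum_const, Finset.card_range, nsmul_eq_mul]
    field_simp
  have hR := ((Complex.continuous_ofReal.tendsto _).comp hh.tendsto_riemannSum).mul_const L
  have := hR.add (hh.tendsto_weighted_mean_zero he)
  rw [add_zero] at this
  refine this.congr fun N => ?_
  simp only [Function.comp_apply, Complex.ofReal_mul, Complex.ofReal_inv, Complex.ofReal_natCast,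
    Complex.ofReal_sum, mul_assoc, Finset.sum_mul, ← mul_add, ← Finset.sum_add_distrib]
  congr 1
  exact Finset.sum_congr rfl fun j _ => by ring

end WeightedMeans

section FourierCoefficients

lemma hasDerivAt_exp_neg_I_mul (k : ℤ) (x : ℝ) :
    HasDerivAt (fun x : ℝ => Complex.exp (-Complex.I * k * x))
      (-Complex.I * k * Complex.exp (-Complex.I * k * x)) x := by
  have h := ((hasDerivAt_id (x : ℂ)).const_mul (-Complex.I * k)).cexp.comp_ofReal
  simpa [mul_comm] using h

lemma exp_neg_I_mul_add_two_pi (k : ℤ) (x : ℝ) :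
    Complex.exp (-Complex.I * k * ((x + 2 * π : ℝ) : ℂ)) = Complex.exp (-Complex.I * k * x) := by
  rw [Complex.exp_eq_exp_iff_exists_int]
  exact ⟨-k, by push_cast; ring⟩

lemma fourierCoef_add {f g : ℝ → ℂ} (hf : IntervalIntegrable f volume (-π) π)
    (hg : IntervalIntegrable g volume (-π) π) (k : ℤ) :
    fourierCoef (fun x => f x + g x) k = fourierCoef f k + fourierCoef g k := by
  have he : Continuous fun x : ℝ => Complex.exp (-Complex.I * k * x) := by fun_prop
  simp only [fourierCoef, add_mul]
  rw [intervalIntegral.integral_add (hf.mul_continuousOn he.continuousOn)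
    (hg.mul_continuousOn he.continuousOn), mul_add]

lemma fourierCoef_const_mul (a : ℂ) (f : ℝ → ℂ) (k : ℤ) :
    fourierCoef (fun x => a * f x) k = a * fourierCoef f k := by
  simp only [fourierCoef, mul_assoc, intervalIntegral.integral_const_mul]
  ring

/-- Translating a periodic function multiplies its Fourier coefficients by a phase. -/
lemma fourierCoef_comp_sub {f : ℝ → ℂ} (hf : Function.Periodic f (2 * π)) (ξ : ℝ) (k : ℤ) :
    fourierCoef (fun x => f (x - ξ)) k =
      Complex.exp (-Complex.I * k * ξ) *
        ((1 / (2 * (π : ℂ))) *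
          ∫ x in (0 : ℝ)..(2 * π), f x * Complex.exp (-Complex.I * k * x)) := by
  have hper : Function.Periodic (fun x : ℝ => f x * Complex.exp (-Complex.I * k * x)) (2 * π) :=
    fun x => by simp only [hf x, exp_neg_I_mul_add_two_pi]
  have hsplit (x : ℝ) : f (x - ξ) * Complex.exp (-Complex.I * k * x) =
      Complex.exp (-Complex.I * k * ξ) *
        (f (x - ξ) * Complex.exp (-Complex.I * k * ((x - ξ : ℝ) : ℂ))) := by
    rw [mul_left_comm, ← Complex.exp_add]
    congr 2
    push_cast; ring
  simp only [fourierCoef, hsplit, intervalIntegral.integral_const_mul]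
  rw [intervalIntegral.integral_comp_sub_right
    (fun x : ℝ => f x * Complex.exp (-Complex.I * k * x)) ξ,
    show π - ξ = (-π - ξ) + 2 * π by ring, hper.intervalIntegral_add_eq (-π - ξ) 0, zero_add]
  ring

lemma fourierCoef_deriv {f f' : ℝ → ℂ} (hf : Function.Periodic f (2 * π))
    (hd : ∀ x, HasDerivAt f (f' x) x) (hf' : Continuous f') (k : ℤ) :
    fourierCoef f' k = Complex.I * k * fourierCoef f k := by
  have he : Continuous fun x : ℝ => Complex.exp (-Complex.I * k * x) := by fun_prop
  have hfc : Continuous f := continuous_iff_continuousAt.2 fun x => (hd x).continuousAt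
  have h := intervalIntegral.integral_mul_deriv_eq_deriv_mul (a := -π) (b := π)
    (fun x _ => hd x) (fun x _ => hasDerivAt_exp_neg_I_mul k x)
    (hf'.intervalIntegrable _ _) ((continuous_const.mul he).intervalIntegrable _ _)
  have hfπ : f π = f (-π) := by rw [← hf (-π)]; congr 1; ring
  have heπ := exp_neg_I_mul_add_two_pi k (-π)
  rw [show -π + 2 * π = π by ring] at heπ
  rw [hfπ, heπ, sub_self, zero_sub] at h
  have h2 : ∫ x in (-π)..π, f x * (-Complex.I * k * Complex.exp (-Complex.I * k * x)) =
      -Complex.I * k * ∫ x in (-π)..π, f x * Complex.exp (-Complex.I * k * x) := by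
    rw [← intervalIntegral.integral_const_mul]
    congr 1; ext x; ring
  rw [h2] at h
  simp only [fourierCoef]
  linear_combination (1 / (2 * (π : ℂ))) * h

lemma exists_norm_fourierCoef_le {f : ℝ → ℂ} (hf : Continuous f) :
    ∃ C, ∀ k, ‖fourierCoef f k‖ ≤ C := by
  obtain ⟨C, hC⟩ := (isCompact_Icc (a := -π) (b := π)).exists_bound_of_continuousOn hf.continuousOn
  refine ⟨‖(1 / (2 * (π : ℂ)))‖ * (C * |π - -π|), fun k => ?_⟩
  rw [fourierCoef, norm_mul]
  gcongr
  refine intervalIntegral.norm_integral_le_of_norm_le_const fun x hx => ?_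
  rw [Set.uIoc_of_le (by linarith [pi_pos])] at hx
  have : ‖Complex.exp (-Complex.I * k * x)‖ = 1 := by
    rw [show -Complex.I * k * (x : ℂ) = ((-(k * x) : ℝ) : ℂ) * Complex.I by push_cast; ring]
    exact Complex.norm_exp_ofReal_mul_I _
  rw [norm_mul, this, mul_one]
  exact hC x ⟨hx.1.le, hx.2⟩

lemma Function.Periodic.of_hasDerivAt {f f' : ℝ → ℂ} {T : ℝ} (hf : Function.Periodic f T)
    (hd : ∀ x, HasDerivAt f (f' x) x) : Function.Periodic f' T := fun x => by
  have h := (hd (x + T)).comp_add_const x T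
  rw [show (fun x => f (x + T)) = f from funext hf] at h
  exact h.unique (hd x)

/-- Fourier coefficients of a periodic `C²` function are `O(k⁻²)`. -/
lemma exists_norm_sq_mul_fourierCoef_le {g : ℝ → ℝ} (hper : Function.Periodic g (2 * π))
    (hg : ContDiff ℝ 2 g) :
    ∃ C, ∀ k : ℤ, ‖(k : ℂ) ^ 2 * fourierCoef (fun x => (g x : ℂ)) k‖ ≤ C := by
  have hg' : ContDiff ℝ 1 (deriv g) := hg.iterate_deriv' 1 1
  have hd1 (x : ℝ) : HasDerivAt (fun x => (g x : ℂ)) ((deriv g x : ℝ) : ℂ) x :=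
    ((hg.differentiable (by norm_num)) x).hasDerivAt.ofReal_comp
  have hd2 (x : ℝ) : HasDerivAt (fun x => ((deriv g x : ℝ) : ℂ)) ((deriv (deriv g) x : ℝ) : ℂ) x :=
    ((hg'.differentiable (by norm_num)) x).hasDerivAt.ofReal_comp
  have hc1 : Continuous fun x => ((deriv g x : ℝ) : ℂ) := Complex.continuous_ofReal.comp hg'.continuous
  have hc2 : Continuous fun x => ((deriv (deriv g) x : ℝ) : ℂ) :=
    Complex.continuous_ofReal.comp (hg'.continuous_deriv le_rfl)
  have hp : Function.Periodic (fun x => (g x : ℂ)) (2 * π) := fun x => by simp only [hper x]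
  obtain ⟨C, hC⟩ := exists_norm_fourierCoef_le hc2
  refine ⟨C, fun k => le_of_eq_of_le ?_ (hC k)⟩
  rw [fourierCoef_deriv (hp.of_hasDerivAt hd1) hd2 hc2, fourierCoef_deriv hp hd1 hc1,
    ← norm_neg]
  congr 1
  linear_combination (-(k : ℂ) ^ 2 * fourierCoef (fun x => (g x : ℂ)) k) * Complex.I_sq

end FourierCoefficients

section Ramp

lemma ramp_eq_of_mem_Ioc {r0 : ℝ → ℝ} (hr0per : ∀ x : ℝ, r0 (x + 2 * π) = r0 x)
    (h1 : ∀ x : ℝ, -π ≤ x → x ≤ 0 → r0 x = (-x - π) / (2 * π))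
    (h2 : ∀ x : ℝ, 0 < x → x ≤ π → r0 x = (π - x) / (2 * π))
    {x : ℝ} (hx : x ∈ Set.Ioc 0 (2 * π)) : r0 x = (π - x) / (2 * π) := by
  rcases le_or_gt x π with h | h
  · exact h2 x hx.1 h
  · rw [← sub_add_cancel x (2 * π), hr0per, h1 _ (by linarith) (by linarith [hx.2])]
    ring

lemma intervalIntegrable_ramp {r0 : ℝ → ℝ} (hr0per : ∀ x : ℝ, r0 (x + 2 * π) = r0 x)
    (h1 : ∀ x : ℝ, -π ≤ x → x ≤ 0 → r0 x = (-x - π) / (2 * π))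
    (h2 : ∀ x : ℝ, 0 < x → x ≤ π → r0 x = (π - x) / (2 * π))
    (a b : ℝ) : IntervalIntegrable r0 volume a b := by
  refine Function.Periodic.intervalIntegrable₀ hr0per two_pi_pos.ne' ?_ a b
  refine (intervalIntegrable_congr fun x hx => ?_).2
    (Continuous.intervalIntegrable (u := fun x => (π - x) / (2 * π)) (by fun_prop) _ _)
  rw [Set.uIoc_of_le two_pi_pos.le] at hx
  exact ramp_eq_of_mem_Ioc hr0per h1 h2 hx

lemma fourierCoef_ramp_comp_sub {r0 : ℝ → ℝ} (hr0per : ∀ x : ℝ, r0 (x + 2 * π) = r0 x)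
    (h1 : ∀ x : ℝ, -π ≤ x → x ≤ 0 → r0 x = (-x - π) / (2 * π))
    (h2 : ∀ x : ℝ, 0 < x → x ≤ π → r0 x = (π - x) / (2 * π))
    (ξ : ℝ) {k : ℤ} (hk : k ≠ 0) :
    fourierCoef (fun x => (r0 (x - ξ) : ℂ)) k =
      Complex.exp (-Complex.I * k * ξ) / (2 * π * Complex.I * k) := by
  have hk' : (k : ℂ) ≠ 0 := by exact_mod_cast hk
  have hπ : (π : ℂ) ≠ 0 := by exact_mod_cast pi_ne_zero
  have hp : Function.Periodic (fun x => (r0 x : ℂ)) (2 * π) := fun x => by simp only [hr0per x]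
  have hint : ∫ x in (0 : ℝ)..(2 * π), (r0 x : ℂ) * Complex.exp (-Complex.I * k * x) =
      1 / (Complex.I * k) := by
    rw [intervalIntegral.integral_congr_Ioo_of_le two_pi_pos.le
      (g := fun x : ℝ => ((π - x) / (2 * π) : ℂ) * Complex.exp (-Complex.I * k * x))
      fun x hx => by
        simp only [ramp_eq_of_mem_Ioc hr0per h1 h2 (Set.Ioo_subset_Ioc_self hx)]; push_cast; rfl]
    have hF (x : ℝ) : HasDerivAt
        (fun x : ℝ => ((π - x) / (2 * π) / (-Complex.I * k) - 1 / (2 * π * k ^ 2) : ℂ) *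
          Complex.exp (-Complex.I * k * x))
        (((π - x) / (2 * π) : ℂ) * Complex.exp (-Complex.I * k * x)) x := by
      have hlin : HasDerivAt
          (fun x : ℝ => ((π - x) / (2 * π) / (-Complex.I * k) - 1 / (2 * π * k ^ 2) : ℂ))
          (-1 / (2 * π) / (-Complex.I * k)) x :=
        ((((hasDerivAt_id (x : ℂ)).const_sub (π : ℂ)).div_const (2 * π)).div_const
          (-Complex.I * k)).sub_const (1 / (2 * π * (k : ℂ) ^ 2)) |>.comp_ofReal
      refine (hlin.mul (hasDerivAt_exp_neg_I_mul k x)).congr_deriv ?_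
      have hI := Complex.I_ne_zero
      field_simp
      ring_nf
      simp only [Complex.I_sq]
      ring
    rw [intervalIntegral.integral_eq_sub_of_hasDerivAt (fun x _ => hF x)
      (Continuous.intervalIntegrable (by fun_prop) _ _)]
    have he := exp_neg_I_mul_add_two_pi k 0
    rw [zero_add] at he
    rw [he]
    have hI := Complex.I_ne_zero
    simp only [Complex.ofReal_zero, mul_zero, Complex.exp_zero]
    push_cast
    field_simp
    ring
  rw [fourierCoef_comp_sub hp, hint]
  field_simp

end Ramp

section ConcentrationSum

lemma sum_Icc_neg_sdiff_zero {M : Type*} [AddCommMonoid M] (F : ℤ → M) (N : ℕ) :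
    ∑ k ∈ Finset.Icc (-(N : ℤ)) N \ {0}, F k =
      ∑ j ∈ Finset.range N, (F (j + 1 : ℕ) + F (-(j + 1 : ℕ))) := by
  induction N with
  | zero => simp
  | succ N ih =>
    have hset : Finset.Icc (-((N + 1 : ℕ) : ℤ)) (N + 1 : ℕ) \ {0} =
        insert ((N + 1 : ℕ) : ℤ) (insert (-((N + 1 : ℕ) : ℤ))
          (Finset.Icc (-(N : ℤ)) N \ {0})) := by
      ext k
      simp only [Finset.mem_sdiff, Finset.mem_Icc, Finset.mem_singleton, Finset.mem_insert]
      omega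
    rw [hset, Finset.sum_insert, Finset.sum_insert, ih, Finset.sum_range_succ, ← add_assoc,
      add_comm]
    all_goals
      simp only [Finset.mem_sdiff, Finset.mem_Icc, Finset.mem_singleton, Finset.mem_insert]
      omega

/-- The contribution of the frequencies `±(j + 1)` to the concentration sum, with the factor
`σ` removed and weighted by the frequency. -/
noncomputable def concTerm (f : ℝ → ℂ) (x : ℝ) (j : ℕ) : ℂ :=
  Complex.I * (j + 1 : ℕ) *
    (fourierCoef f (j + 1 : ℕ) * Complex.exp (Complex.I * (j + 1 : ℕ) * x) -
      fourierCoef f (-(j + 1 : ℕ)) * Complex.exp (-Complex.I * (j + 1 : ℕ) * x))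

lemma concSum_eq_weighted_mean {σ h : ℝ → ℝ} (hext : ∀ η ∈ Set.Ioc (0 : ℝ) 1, h η = σ η / η)
    (f : ℝ → ℂ) (x : ℝ) (N : ℕ) :
    concSum σ N f x =
      (N : ℂ)⁻¹ * ∑ j ∈ Finset.range N, (h ((j + 1 : ℕ) / N) : ℂ) * concTerm f x j := by
  rw [concSum, sum_Icc_neg_sdiff_zero, Finset.mul_sum, Finset.mul_sum]
  refine Finset.sum_congr rfl fun j hj => ?_
  rw [Finset.mem_range] at hj
  have hN : (0 : ℝ) < N := by exact_mod_cast (Nat.zero_le j).trans_lt hj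
  have hN' : (N : ℂ) ≠ 0 := by exact_mod_cast hN.ne'
  have hη : (0 : ℝ) < (j + 1 : ℕ) / N := by positivity
  have hσ : σ ((j + 1 : ℕ) / N) = h ((j + 1 : ℕ) / N) * ((j + 1 : ℕ) / N) := by
    rw [hext _ ⟨hη, (div_mem_Icc_zero_one (by exact_mod_cast hN) hj).2⟩, div_mul_cancel₀ _ hη.ne']
  have hs : Int.sign ((j + 1 : ℕ) : ℤ) = 1 := Int.sign_eq_one_of_pos (by positivity)
  simp only [Int.sign_neg, hs, Int.cast_neg, Int.cast_natCast, abs_neg, Nat.abs_cast, hσ, concTerm]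
  push_cast
  field_simp
  ring

lemma concTerm_smooth_tendsto_zero {g : ℝ → ℝ} (hper : Function.Periodic g (2 * π))
    (hg : ContDiff ℝ 2 g) (x : ℝ) :
    Tendsto (concTerm (fun y => (g y : ℂ)) x) atTop (𝓝 0) := by
  obtain ⟨C, hC⟩ := exists_norm_sq_mul_fourierCoef_le hper hg
  have hlim : Tendsto (fun j : ℕ => 2 * C / ((j + 1 : ℕ) : ℝ)) atTop (𝓝 0) :=
    (tendsto_const_div_atTop_nhds_zero_nat (2 * C)).comp (tendsto_add_atTop_nat 1)
  refine squeeze_zero_norm (fun j => ?_) hlim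
  have hj : (0 : ℝ) < (j + 1 : ℕ) := by positivity
  have hp := hC (j + 1 : ℕ)
  have hn := hC (-(j + 1 : ℕ))
  have e1 : ‖Complex.exp (Complex.I * (j + 1 : ℕ) * x)‖ = 1 := by
    rw [show Complex.I * (j + 1 : ℕ) * (x : ℂ) = (((j + 1 : ℕ) * x : ℝ) : ℂ) * Complex.I by
      push_cast; ring]
    exact Complex.norm_exp_ofReal_mul_I _
  have e2 : ‖Complex.exp (-Complex.I * (j + 1 : ℕ) * x)‖ = 1 := by
    rw [show -Complex.I * (j + 1 : ℕ) * (x : ℂ) = ((-((j + 1 : ℕ) * x) : ℝ) : ℂ) * Complex.I by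
      push_cast; ring]
    exact Complex.norm_exp_ofReal_mul_I _
  rw [norm_mul, norm_pow, Int.cast_natCast, Complex.norm_natCast] at hp
  rw [norm_mul, norm_pow, Int.cast_neg, norm_neg, Int.cast_natCast, Complex.norm_natCast] at hn
  rw [concTerm, norm_mul, norm_mul, Complex.norm_I, one_mul, Complex.norm_natCast, le_div_iff₀ hj]
  have hsub := norm_sub_le
    (fourierCoef (fun y => (g y : ℂ)) (j + 1 : ℕ) * Complex.exp (Complex.I * (j + 1 : ℕ) * x))
    (fourierCoef (fun y => (g y : ℂ)) (-(j + 1 : ℕ)) * Complex.exp (-Complex.I * (j + 1 : ℕ) * x))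
  rw [norm_mul, norm_mul, e1, e2, mul_one, mul_one] at hsub
  have := mul_le_mul_of_nonneg_left hsub (sq_nonneg ((j + 1 : ℕ) : ℝ))
  linarith

lemma concTerm_ramp_add_smooth {r0 : ℝ → ℝ} (hr0per : ∀ x : ℝ, r0 (x + 2 * π) = r0 x)
    (h1 : ∀ x : ℝ, -π ≤ x → x ≤ 0 → r0 x = (-x - π) / (2 * π))
    (h2 : ∀ x : ℝ, 0 < x → x ≤ π → r0 x = (π - x) / (2 * π))
    {g : ℝ → ℝ} (hg : Continuous g) (a ξ x : ℝ) (j : ℕ) :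
    concTerm (fun y => ((a * r0 (y - ξ) + g y : ℝ) : ℂ)) x j =
      a / (2 * π) * (Complex.exp (Complex.I * (x - ξ)) ^ (j + 1) +
        Complex.exp (-(Complex.I * (x - ξ))) ^ (j + 1)) + concTerm (fun y => (g y : ℂ)) x j := by
  have hr : IntervalIntegrable (fun y => (r0 (y - ξ) : ℂ)) volume (-π) π := by
    have := (intervalIntegrable_ramp hr0per h1 h2 (-π - ξ) (π - ξ)).comp_sub_right ξ
    simp only [sub_add_cancel] at this
    exact ⟨this.1.ofReal, this.2.ofReal⟩
  have hcoef (k : ℤ) (hk : k ≠ 0) : fourierCoef (fun y => ((a * r0 (y - ξ) + g y : ℝ) : ℂ)) k =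
      a * (Complex.exp (-Complex.I * k * ξ) / (2 * π * Complex.I * k)) +
        fourierCoef (fun y => (g y : ℂ)) k := by
    rw [← fourierCoef_ramp_comp_sub hr0per h1 h2 ξ hk, ← fourierCoef_const_mul,
      ← fourierCoef_add (hr.const_mul _) (g := fun y => (g y : ℂ))
        ((Complex.continuous_ofReal.comp hg).intervalIntegrable _ _)]
    push_cast
    rfl
  have hj : ((j + 1 : ℕ) : ℤ) ≠ 0 := by positivity
  have hj' : ((j + 1 : ℕ) : ℂ) ≠ 0 := by exact_mod_cast hj
  have hπ : (π : ℂ) ≠ 0 := by exact_mod_cast pi_ne_zero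
  have hI := Complex.I_ne_zero
  have e1 : Complex.exp (Complex.I * (x - ξ)) ^ (j + 1) =
      Complex.exp (-Complex.I * (j + 1 : ℕ) * ξ) * Complex.exp (Complex.I * (j + 1 : ℕ) * x) := by
    rw [← Complex.exp_nat_mul, ← Complex.exp_add]; congr 1; ring
  have e2 : Complex.exp (-(Complex.I * (x - ξ))) ^ (j + 1) =
      Complex.exp (Complex.I * (j + 1 : ℕ) * ξ) * Complex.exp (-Complex.I * (j + 1 : ℕ) * x) := by
    rw [← Complex.exp_nat_mul, ← Complex.exp_add]; congr 1; ring
  rw [concTerm, concTerm, hcoef _ hj, hcoef _ (neg_ne_zero.2 hj), e1, e2]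
  simp only [Int.cast_neg, Int.cast_natCast]
  rw [show -Complex.I * -((j + 1 : ℕ) : ℂ) * ξ = Complex.I * (j + 1 : ℕ) * ξ by ring]
  field_simp
  ring

lemma tendsto_mean_pow_succ_of_norm_eq_one {z : ℂ} (hz : ‖z‖ = 1) (hz1 : z ≠ 1) :
    Tendsto (fun N : ℕ => (N : ℂ)⁻¹ * ∑ j ∈ Finset.range N, z ^ (j + 1)) atTop (𝓝 0) := by
  refine squeeze_zero_norm (fun N => ?_)
    (tendsto_const_div_atTop_nhds_zero_nat (2 / ‖z - 1‖))
  simp_rw [pow_succ, ← Finset.sum_mul]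
  rw [geom_sum_eq hz1, norm_mul, norm_mul, hz, mul_one, norm_div, norm_inv, Complex.norm_natCast,
    inv_mul_eq_div]
  gcongr
  exact (norm_sub_le _ _).trans (by rw [norm_pow, hz]; norm_num)

end ConcentrationSum

/-- For `f(x) = a·r₀(x-ξ) + g(x)` with `g` smooth and 2π-periodic and `r₀` the
2π-periodic ramp function, and an admissible concentration factor `σ` (i.e. `σ(η)/η` extends
to a C¹ function `h` on `[0,1]` with `∫₀¹ h = π`), the concentration factor sum converges to
the jump `a = [f](ξ)` at `x = ξ` and to `0` at every `x` with `x - ξ ∉ 2πℤ`. -/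
theorem concSum_detects_jump (ξ : ℝ) (hξ : ξ ∈ Set.Ioo (-π) π) (a : ℝ)
    (g : ℝ → ℝ) (hgper : Function.Periodic g (2 * π)) (hg : ContDiff ℝ 2 g)
    (r0 : ℝ → ℝ) (hr0per : ∀ x : ℝ, r0 (x + 2 * π) = r0 x)
    (h1 : ∀ x : ℝ, -π ≤ x → x ≤ 0 → r0 x = (-x - π) / (2 * π))
    (h2 : ∀ x : ℝ, 0 < x → x ≤ π → r0 x = (π - x) / (2 * π))
    (σ h : ℝ → ℝ) (hC1 : ContDiffOn ℝ 1 h (Set.Icc 0 1))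
    (hext : ∀ η ∈ Set.Ioc (0 : ℝ) 1, h η = σ η / η)
    (hint : ∫ η in (0 : ℝ)..1, h η = π) :
    Tendsto (fun N : ℕ => concSum σ N (fun x => ((a * r0 (x - ξ) + g x : ℝ) : ℂ)) ξ)
      atTop (nhds (a : ℂ)) ∧
    ∀ x : ℝ, (∀ m : ℤ, x - ξ ≠ 2 * π * m) →
      Tendsto (fun N : ℕ => concSum σ N (fun y => ((a * r0 (y - ξ) + g y : ℝ) : ℂ)) x)
        atTop (nhds (0 : ℂ)) := by
  obtain ⟨K, hK⟩ := hC1.exists_lipschitzOnWith one_ne_zero (convex_Icc 0 1) isCompact_Icc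
  have hsmooth (x : ℝ) : Tendsto
      (fun N : ℕ => (N : ℂ)⁻¹ * ∑ j ∈ Finset.range N, concTerm (fun y => (g y : ℂ)) x j)
      atTop (𝓝 0) := by
    simpa using (concTerm_smooth_tendsto_zero hgper hg x).cesaro_smul
  have hterm (x : ℝ) (L : ℂ) (hL : Tendsto (fun N : ℕ => (N : ℂ)⁻¹ * ∑ j ∈ Finset.range N,
      (a / (2 * π) * (Complex.exp (Complex.I * (x - ξ)) ^ (j + 1) +
        Complex.exp (-(Complex.I * (x - ξ))) ^ (j + 1)))) atTop (𝓝 L)) :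
      Tendsto (fun N : ℕ => concSum σ N (fun y => ((a * r0 (y - ξ) + g y : ℝ) : ℂ)) x)
        atTop (𝓝 (π * L)) := by
    simp only [concSum_eq_weighted_mean hext]
    rw [← hint]
    refine hK.tendsto_weighted_mean ?_
    simp only [concTerm_ramp_add_smooth hr0per h1 h2 hg.continuous, Finset.sum_add_distrib, mul_add]
    simpa [mul_add, Finset.sum_add_distrib] using hL.add (hsmooth x)
  have hπ : (π : ℂ) ≠ 0 := by exact_mod_cast pi_ne_zero
  refine ⟨?_, fun x hx => ?_⟩
  · have hlim := hterm ξ (a / π) ?_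
    · rwa [mul_div_cancel₀ _ hπ] at hlim
    · refine tendsto_const_nhds.congr' ?_
      filter_upwards [eventually_gt_atTop 0] with N hN
      have : (N : ℂ) ≠ 0 := by exact_mod_cast hN.ne'
      simp
      field_simp
      ring
  · have hne (m : ℤ) : Complex.I * (x - ξ) ≠ m * (2 * π * Complex.I) := fun h => by
      refine hx m ?_
      have : ((x - ξ : ℝ) : ℂ) = ((2 * π * m : ℝ) : ℂ) := by
        push_cast
        exact mul_left_cancel₀ Complex.I_ne_zero (h.trans (by ring))
      exact_mod_cast this
    have hz : Complex.exp (Complex.I * (x - ξ)) ≠ 1 := fun h => by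
      obtain ⟨m, hm⟩ := Complex.exp_eq_one_iff.1 h
      exact hne m hm
    have hnorm : ‖Complex.exp (Complex.I * (x - ξ))‖ = 1 := by
      rw [mul_comm, ← Complex.ofReal_sub]
      exact Complex.norm_exp_ofReal_mul_I _
    have hlim := ((tendsto_mean_pow_succ_of_norm_eq_one hnorm hz).add
      (tendsto_mean_pow_succ_of_norm_eq_one (z := Complex.exp (-(Complex.I * (x - ξ))))
        (by rw [Complex.exp_neg, norm_inv, hnorm, inv_one])
        (by rwa [Complex.exp_neg, ne_eq, inv_eq_one]))).const_mul (a / (2 * π) : ℂ)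
    rw [← mul_zero (π : ℂ)]
    refine hterm x 0 ?_
    simp only [add_zero, mul_zero] at hlim
    refine hlim.congr fun N => ?_
    rw [← Finset.mul_sum, Finset.sum_add_distrib]
    ring
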